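/- For every real number x with 0 < |x| < 1/4, the series ∑_{n≥0} C_{n+1}·x^n converges with sum (1 − 2x − √(1 − 4x))/(2x²). (Euler's closed form for the Catalan generating function A(x) = 1 + 2x + 5x² + 14x³ + ⋯, 1751.) -/

import Mathlib

lemma catalan_term_succ (t : ℝ) (n : ℕ) :
    (catalan (n + 1) : ℝ) * t ^ (n + 1) =
      t * ∑ k ∈ Finset.range (n + 1), ((catalan k : ℝ) * t ^ k) *
        ((catalan (n - k) : ℝ) * t ^ (n - k)) := by
  rw [catalan_succ, Fin.sum_univ_eq_sum_range (fun i => catalan i * catalan (n - i)) n.succ,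
    Nat.cast_sum, Finset.sum_mul, Finset.mul_sum]
  refine Finset.sum_congr rfl fun k hk => ?_
  have hk' : k ≤ n := by simpa [Nat.lt_succ_iff] using hk
  obtain ⟨m, rfl⟩ := Nat.exists_eq_add_of_le hk'
  simp only [Nat.add_sub_cancel_left]
  push_cast
  ring

lemma catalan_partial_le (t : ℝ) (h0 : 0 ≤ t) (h1 : t ≤ 1 / 4) (N : ℕ) :
    ∑ n ∈ Finset.range N, (catalan n : ℝ) * t ^ n ≤ 2 := by
  induction N with
  | zero => simp
  | succ N ih =>
    have hpos : ∀ n : ℕ, 0 ≤ (catalan n : ℝ) * t ^ n := fun n => by positivity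
    have hS : 0 ≤ ∑ n ∈ Finset.range N, (catalan n : ℝ) * t ^ n :=
      Finset.sum_nonneg fun n _ => hpos n
    rw [Finset.sum_range_succ']
    simp_rw [catalan_term_succ]
    rw [← Finset.mul_sum, Finset.sum_range_diag_flip N
      (fun a b => ((catalan a : ℝ) * t ^ a) * ((catalan b : ℝ) * t ^ b))]
    have h2 : ∑ m ∈ Finset.range N, ∑ k ∈ Finset.range (N - m),
        ((catalan m : ℝ) * t ^ m) * ((catalan k : ℝ) * t ^ k) ≤
        (∑ n ∈ Finset.range N, (catalan n : ℝ) * t ^ n) *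
          (∑ n ∈ Finset.range N, (catalan n : ℝ) * t ^ n) := by
      rw [Finset.sum_mul_sum]
      refine Finset.sum_le_sum fun m _ => ?_
      refine Finset.sum_le_sum_of_subset_of_nonneg ?_ fun k _ _ => mul_nonneg (hpos m) (hpos k)
      exact Finset.range_subset_range.2 (Nat.sub_le _ _)
    have h3 := mul_le_mul_of_nonneg_left h2 h0
    simp only [catalan_zero, pow_zero, Nat.cast_one, mul_one]
    nlinarith [mul_self_nonneg (∑ n ∈ Finset.range N, (catalan n : ℝ) * t ^ n)]

/-- Euler's closed form for the Catalan generating function (1751): for `0 < |x| < 1/4`,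
`∑_{n≥0} C_{n+1}·xⁿ = (1 − 2x − √(1 − 4x))/(2x²)`. -/
theorem euler_catalan_gf (x : ℝ) (hx0 : 0 < |x|) (hx : |x| < 1 / 4) :
    HasSum (fun n : ℕ => (catalan (n + 1) : ℝ) * x ^ n)
      ((1 - 2 * x - Real.sqrt (1 - 4 * x)) / (2 * x ^ 2)) := by
  have hxne : x ≠ 0 := abs_pos.1 hx0
  have hnorm : ∀ n : ℕ, ‖(catalan n : ℝ) * x ^ n‖ = (catalan n : ℝ) * |x| ^ n := fun n => by
    simp
  have hsn : Summable fun n : ℕ => ‖(catalan n : ℝ) * x ^ n‖ := by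
    refine summable_of_sum_range_le (c := 2) (fun n => norm_nonneg _) fun N => ?_
    simp_rw [hnorm]
    exact catalan_partial_le _ hx0.le hx.le N
  have hs : Summable fun n : ℕ => (catalan n : ℝ) * x ^ n := hsn.of_norm
  set c : ℝ := ∑' n : ℕ, (catalan n : ℝ) * x ^ n with hc
  have hcb : |c| ≤ 2 := by
    refine (norm_tsum_le_tsum_norm hsn).trans ?_
    refine Real.tsum_le_of_sum_range_le (fun n => norm_nonneg _) fun N => ?_
    simp_rw [hnorm]
    exact catalan_partial_le _ hx0.le hx.le N
  have hsq : c = 1 + x * (c * c) := by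
    have e1 : c * c = _ := tsum_mul_tsum_eq_tsum_sum_range_of_summable_norm hsn hsn
    rw [e1, ← tsum_mul_left]
    simp_rw [← catalan_term_succ]
    rw [hc, hs.tsum_eq_zero_add]
    simp
  have hsqrt : Real.sqrt (1 - 4 * x) = 1 - 2 * x * c := by
    have h1 : 1 - 4 * x = (1 - 2 * x * c) ^ 2 := by linear_combination (4 * x) * hsq
    rw [h1, Real.sqrt_sq]
    have h2 : |x * c| ≤ 1 / 4 * 2 := by
      rw [abs_mul]
      exact mul_le_mul hx.le hcb (abs_nonneg _) (by norm_num)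
    have := (abs_le.1 h2).2
    linarith
  have h1 : HasSum (fun n : ℕ => (catalan (n + 1) : ℝ) * x ^ (n + 1)) (c - 1) := by
    have := (hasSum_nat_add_iff' (f := fun n : ℕ => (catalan n : ℝ) * x ^ n) 1).2 hs.hasSum
    simpa using this
  have h2 := h1.mul_left x⁻¹
  have e1 : (fun n : ℕ => (catalan (n + 1) : ℝ) * x ^ n) =
      fun n : ℕ => x⁻¹ * ((catalan (n + 1) : ℝ) * x ^ (n + 1)) := by
    funext n
    field_simp
    ring
  have e2 : (1 - 2 * x - Real.sqrt (1 - 4 * x)) / (2 * x ^ 2) = x⁻¹ * (c - 1) := by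
    rw [hsqrt]
    field_simp
    ring
  rw [e1, e2]
  exact h2
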